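/- (VPBoost converges to a stationary point.) In the VPBoost setting with acceptance threshold ρ_accept ∈ (0, 1), the iterates produced by the algorithm satisfy lim_{m→∞} ‖∇L(f_m)‖ = 0. -/

import Mathlib

open scoped RealInnerProductSpace
open Filter

/-- The gradient of a `C²` function is continuously differentiable. -/
theorem contDiff_gradient_of_contDiff_two {F : Type*} [NormedAddCommGroup F]
    [InnerProductSpace ℝ F] [CompleteSpace F] {L : F → ℝ} (hL : ContDiff ℝ 2 L) :
    ContDiff ℝ 1 (gradient L) :=
  (InnerProductSpace.toDual ℝ F).symm.contDiff.comp
    (hL.fderiv_right (m := 1) (by norm_num))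

/-- The descent lemma for a `C²` function whose Hessian is bounded by `β`. -/
theorem le_add_inner_gradient_add_sq {F : Type*} [NormedAddCommGroup F]
    [InnerProductSpace ℝ F] [CompleteSpace F] {L : F → ℝ} {β : ℝ} (hL : ContDiff ℝ 2 L)
    (hβ : ∀ x, ‖fderiv ℝ (gradient L) x‖ ≤ β) (x h : F) :
    L (x + h) ≤ L x + ⟪gradient L x, h⟫ + β / 2 * ‖h‖ ^ 2 := by
  have hgrad : ∀ y, ‖gradient L y - gradient L x‖ ≤ β * ‖y - x‖ := fun y =>
    convex_univ.norm_image_sub_le_of_norm_fderiv_le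
      (fun z _ => ((contDiff_gradient_of_contDiff_two hL).differentiable one_ne_zero) z)
      (fun z _ => hβ z) (Set.mem_univ x) (Set.mem_univ y)
  have hderiv : ∀ t : ℝ, HasDerivAt
      (fun t : ℝ => L (x + t • h) - t * ⟪gradient L x, h⟫ - β / 2 * ‖h‖ ^ 2 * t ^ 2)
      (⟪gradient L (x + t • h), h⟫ - ⟪gradient L x, h⟫ - β * ‖h‖ ^ 2 * t) t := by
    intro t
    have hpath : HasDerivAt (fun t : ℝ => x + t • h) h t := by
      simpa using ((hasDerivAt_id t).smul_const h).const_add x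
    have hLd : HasDerivAt (fun t : ℝ => L (x + t • h)) ⟪gradient L (x + t • h), h⟫ t := by
      have := ((hL.differentiable two_ne_zero) (x + t • h)).hasGradientAt.hasFDerivAt
      exact this.comp_hasDerivAt t hpath
    have hlin := (hasDerivAt_id t).mul_const ⟪gradient L x, h⟫
    have hquad := ((hasDerivAt_id t).pow 2).const_mul (β / 2 * ‖h‖ ^ 2)
    refine ((hLd.sub hlin).sub hquad).congr_deriv ?_
    simp
    ring
  have hanti := antitoneOn_of_deriv_nonpos (convex_Icc (0 : ℝ) 1)
    (fun t _ => (hderiv t).continuousAt.continuousWithinAt)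
    (fun t _ => (hderiv t).differentiableAt.differentiableWithinAt) (by
      intro t ht
      rw [interior_Icc] at ht
      rw [(hderiv t).deriv, ← inner_sub_left]
      have hinner := real_inner_le_norm (gradient L (x + t • h) - gradient L x) h
      have hbound := hgrad (x + t • h)
      rw [add_sub_cancel_left, norm_smul, Real.norm_of_nonneg ht.1.le] at hbound
      nlinarith [mul_le_mul_of_nonneg_right hbound (norm_nonneg h)])
  have := hanti (Set.left_mem_Icc.2 zero_le_one) (Set.right_mem_Icc.2 zero_le_one) zero_le_one
  simp only [one_smul, zero_smul, add_zero, one_pow, zero_mul, mul_one, one_mul, sub_zero,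
    zero_pow two_ne_zero, mul_zero] at this
  linarith

/-- A positive semidefinite operator plus a positive multiple of the identity is invertible. -/
theorem isUnit_add_smul_one_of_inner_nonneg {E : Type*} [NormedAddCommGroup E]
    [InnerProductSpace ℝ E] [CompleteSpace E] {T : E →L[ℝ] E} (hT : ∀ v, 0 ≤ ⟪T v, v⟫)
    {c : ℝ} (hc : 0 < c) : IsUnit (T + c • (1 : E →L[ℝ] E)) := by
  refine ContinuousLinearMap.isUnit_of_forall_le_norm_inner_map _ (c := ⟨c, hc.le⟩) hc ?_
  intro v
  have hexpand : ⟪(T + c • (1 : E →L[ℝ] E)) v, v⟫ = ⟪T v, v⟫ + c * ‖v‖ ^ 2 := by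
    simp [inner_add_left, real_inner_smul_left]
  rw [hexpand, Real.norm_of_nonneg (add_nonneg (hT v) (by positivity))]
  change ‖v‖ ^ 2 * c ≤ _
  linarith [hT v]

/-- A positive sequence that is multiplied by `γ > 1` at some stages, constant at the others, and
never multiplied above a threshold, is bounded, and is multiplied only finitely often. -/
theorem exists_bound_and_eventually_not_of_scaling {u : ℕ → ℝ} {p : ℕ → Prop} {γ C : ℝ}
    (hγ : 1 < γ) (h0 : 0 < u 0) (hp : ∀ m, p m → u (m + 1) = γ * u m)
    (hn : ∀ m, ¬ p m → u (m + 1) = u m) (hC : ∀ m, 0 < u m → p m → u m ≤ C) :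
    Monotone u ∧ (∃ K, ∀ m, u m ≤ K) ∧ ∀ᶠ m in atTop, ¬ p m := by
  have hpos : ∀ m, 0 < u m := by
    intro m
    induction m with
    | zero => exact h0
    | succ k ih =>
      by_cases hk : p k
      · rw [hp k hk]; positivity
      · rwa [hn k hk]
  have hmono : Monotone u := by
    refine monotone_nat_of_le_succ fun m => ?_
    by_cases hm : p m
    · rw [hp m hm]; nlinarith [hpos m]
    · rw [hn m hm]
  have hbound : ∀ m, u m ≤ max (u 0) (γ * C) := by
    intro m
    induction m with
    | zero => exact le_max_left _ _
    | succ k ih =>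
      by_cases hk : p k
      · rw [hp k hk]
        exact le_max_of_le_right
          (mul_le_mul_of_nonneg_left (hC k (hpos k) hk) (by positivity))
      · rwa [hn k hk]
  refine ⟨hmono, ⟨_, hbound⟩, ?_⟩
  have hbdd : BddAbove (Set.range u) := ⟨_, Set.forall_mem_range.2 hbound⟩
  have hlim := tendsto_atTop_ciSup hmono hbdd
  have hsup : 0 < ⨆ m, u m := h0.trans_le (le_ciSup hbdd 0)
  have hlt : (⨆ m, u m) / γ < ⨆ m, u m := div_lt_self hsup hγ
  filter_upwards [hlim.eventually (lt_mem_nhds hlt)] with m hm hpm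
  have hle := le_ciSup hbdd (m + 1)
  rw [hp m hpm] at hle
  rw [div_lt_iff₀ (by positivity)] at hm
  linarith

/-- If the decrease of a sequence bounded below eventually dominates `c * ‖g m‖ ^ 2`, then
`‖g m‖` tends to zero. -/
theorem tendsto_norm_zero_of_sufficient_decrease {G : Type*} [NormedAddCommGroup G]
    {u : ℕ → ℝ} {g : ℕ → G} {c : ℝ} (hc : 0 < c) (hbdd : BddBelow (Set.range u))
    (hdec : ∀ᶠ m in atTop, c * ‖g m‖ ^ 2 ≤ u m - u (m + 1)) :
    Tendsto (fun m => ‖g m‖) atTop (nhds 0) := by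
  obtain ⟨N, hN⟩ := eventually_atTop.1 hdec
  have hanti : Antitone fun m => u (m + N) := by
    refine antitone_nat_of_succ_le fun m => ?_
    have := hN (m + N) (Nat.le_add_left _ _)
    rw [show m + 1 + N = m + N + 1 by ring]
    nlinarith [mul_nonneg hc.le (sq_nonneg ‖g (m + N)‖)]
  have hlim := tendsto_atTop_ciInf hanti (hbdd.mono (Set.range_comp_subset_range (· + N) u))
  rw [tendsto_add_atTop_iff_nat (f := u)] at hlim
  have hdiff : Tendsto (fun m => (u m - u (m + 1)) / c) atTop (nhds 0) := by
    simpa using (hlim.sub ((tendsto_add_atTop_iff_nat 1).2 hlim)).div_const c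
  have hsq : Tendsto (fun m => ‖g m‖ ^ 2) atTop (nhds 0) := by
    refine tendsto_of_tendsto_of_tendsto_of_le_of_le' tendsto_const_nhds hdiff
      (Eventually.of_forall fun m => sq_nonneg _) ?_
    filter_upwards [hdec] with m hm
    rw [le_div_iff₀ hc]
    linarith
  simpa using hsq.sqrt

/-- **VPBoost converges to a stationary point.** In the VPBoost setting with
acceptance threshold `ρ_accept ∈ (0, 1)`, the iterates satisfy `‖∇L(f_m)‖ → 0`. -/
theorem stmt16
    {F : Type*} [NormedAddCommGroup F] [InnerProductSpace ℝ F] [CompleteSpace F]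
    (n : ℕ) (L : F → ℝ)
    (β ρa ρs γup lamLow αlow αhigh κa κc : ℝ)
    -- regularity of the loss functional
    (hL : ContDiff ℝ 2 L)
    (hbdd : BddBelow (Set.range L))
    (hβ : 0 < β)
    (hHsa : ∀ x u v : F,
      ⟪(fderiv ℝ (gradient L) x) u, v⟫ = ⟪u, (fderiv ℝ (gradient L) x) v⟫)
    (hHpsd : ∀ x u : F, 0 ≤ ⟪u, (fderiv ℝ (gradient L) x) u⟫)
    (hHnorm : ∀ x : F, ‖fderiv ℝ (gradient L) x‖ ≤ β)
    -- fixed constants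
    (hρa0 : 0 ≤ ρa) (hρas : ρa < ρs) (hρs1 : ρs < 1)
    (hγup : 1 < γup) (hlamLow : 0 < lamLow)
    (hαlow : 0 < αlow) (hαle : αlow ≤ αhigh)
    (hκa0 : 0 < κa) (hκa1 : κa ≤ 1) (hκc : 0 < κc)
    -- the iterates of the algorithm
    (f : ℕ → F) (lam : ℕ → ℝ) (A : ℕ → EuclideanSpace ℝ (Fin n) →L[ℝ] F)
    (hlam0 : lamLow ≤ lam 0)
    -- derived quantities at stage m
    (g : ℕ → F) (hg : ∀ m, g m = gradient L (f m))
    (Hess : ℕ → F →L[ℝ] F) (hHess : ∀ m, Hess m = fderiv ℝ (gradient L) (f m))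
    (gbar : ℕ → EuclideanSpace ℝ (Fin n))
    (hgbar : ∀ m, gbar m = ContinuousLinearMap.adjoint (A m) (g m))
    (Hred : ℕ → EuclideanSpace ℝ (Fin n) →L[ℝ] EuclideanSpace ℝ (Fin n))
    (hHred : ∀ m, Hred m = ContinuousLinearMap.adjoint (A m) ∘L Hess m ∘L A m)
    (w : ℕ → EuclideanSpace ℝ (Fin n))
    (hw : ∀ m, w m = -((Ring.inverse (Hred m + lam m •
        (1 : EuclideanSpace ℝ (Fin n) →L[ℝ] EuclideanSpace ℝ (Fin n)))) (gbar m)))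
    (step : ℕ → F) (hstep : ∀ m, step m = A m (w m))
    (Q : ℕ → F → ℝ)
    (hQ : ∀ m (x : F), Q m x = ⟪g m, x⟫ + (1 / 2) * ⟪x, (Hess m) x⟫)
    (ρ : ℕ → ℝ)
    (hρ : ∀ m, ρ m = (L (f m) - L (f m + step m)) / (Q m 0 - Q m (step m)))
    -- subspace regularity at every stage
    (hAlow : ∀ m, αlow ≤ ‖A m‖) (hAhigh : ∀ m, ‖A m‖ ≤ αhigh)
    (halign : ∀ m, κa * ‖A m‖ * ‖g m‖ ≤ ‖gbar m‖)
    (hcurve : ∀ m, κc * ⟪g m, (Hess m) (g m)⟫ ≤ ⟪step m, (Hess m) (step m)⟫)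
    -- update rules
    (hupd : ∀ m,
      (g m ≠ 0 →
        (ρa < ρ m → f (m + 1) = f m + step m) ∧
        (¬ ρa < ρ m → f (m + 1) = f m) ∧
        (ρ m < ρs → lam (m + 1) = γup * lam m) ∧
        (¬ ρ m < ρs → lam (m + 1) = lam m)) ∧
      (g m = 0 → f (m + 1) = f m ∧ lam (m + 1) = lam m))
    (hρapos : 0 < ρa) (hρa1 : ρa < 1) :
    Filter.Tendsto (fun m => ‖gradient L (f m)‖) Filter.atTop (nhds 0) := by
  have hpsd : ∀ m v, 0 ≤ ⟪Hred m v, v⟫ := by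
    intro m v
    rw [hHred, real_inner_comm]
    simpa [ContinuousLinearMap.adjoint_inner_right, hHess] using hHpsd (f m) (A m v)
  have hHred_norm : ∀ m, ‖Hred m‖ ≤ β * αhigh ^ 2 := by
    intro m
    rw [hHred]
    have hA : ‖A m‖ ≤ αhigh := hAhigh m
    have hB : ‖Hess m‖ ≤ β := hHess m ▸ hHnorm (f m)
    calc _ ≤ ‖ContinuousLinearMap.adjoint (A m)‖ * (‖Hess m‖ * ‖A m‖) :=
          (ContinuousLinearMap.opNorm_comp_le _ _).trans
            (by gcongr; exact ContinuousLinearMap.opNorm_comp_le _ _)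
      _ ≤ αhigh * (β * αhigh) := by
          rw [LinearIsometryEquiv.norm_map]
          have : 0 ≤ αhigh := (norm_nonneg _).trans hA
          gcongr
      _ = β * αhigh ^ 2 := by ring
  have hnewton : ∀ m, 0 < lam m → Hred m (w m) + lam m • w m = - gbar m := by
    intro m hm
    have hunit := isUnit_add_smul_one_of_inner_nonneg (hpsd m) hm
    have := congrArg (fun T => T (gbar m)) (Ring.mul_inverse_cancel _ hunit)
    rw [hw]
    simp only [mul_apply_eq_comp, one_apply_eq_self,
      add_apply, smul_apply] at this
    rw [map_neg, smul_neg, ← neg_add, this]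
  have hstep_norm : ∀ m, ‖step m‖ ≤ αhigh * ‖w m‖ := fun m => by
    rw [hstep]
    exact (A m).le_of_opNorm_le (hAhigh m) _
  have hinner : ∀ m, 0 < lam m →
      - ⟪g m, step m⟫ = ⟪step m, Hess m (step m)⟫ + lam m * ‖w m‖ ^ 2 := by
    intro m hm
    have hgs : ⟪g m, step m⟫ = ⟪gbar m, w m⟫ := by
      rw [hgbar, hstep, ContinuousLinearMap.adjoint_inner_left]
    have hHs : ⟪step m, Hess m (step m)⟫ = ⟪Hred m (w m), w m⟫ := by
      rw [hHred, hstep, real_inner_comm (w m)]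
      simp [ContinuousLinearMap.adjoint_inner_right]
    rw [hgs, hHs, ← inner_neg_left, ← hnewton m hm, inner_add_left, real_inner_smul_left,
      real_inner_self_eq_norm_sq]
  have hstep_psd : ∀ m, 0 ≤ ⟪step m, Hess m (step m)⟫ := fun m => hHess m ▸ hHpsd (f m) _
  have hpred : ∀ m, 0 < lam m → lam m * ‖w m‖ ^ 2 ≤ Q m 0 - Q m (step m) := by
    intro m hm
    simp only [hQ, inner_zero_right, inner_zero_left]
    linarith [hinner m hm, hstep_psd m]
  have hw_norm : ∀ m, 0 < lam m →
      κa * αlow * ‖g m‖ ≤ (β * αhigh ^ 2 + lam m) * ‖w m‖ := by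
    intro m hm
    calc κa * αlow * ‖g m‖ ≤ κa * ‖A m‖ * ‖g m‖ := by gcongr; exact hAlow m
      _ ≤ ‖gbar m‖ := halign m
      _ = ‖Hred m (w m) + lam m • w m‖ := by rw [hnewton m hm, norm_neg]
      _ ≤ ‖Hred m‖ * ‖w m‖ + lam m * ‖w m‖ :=
          (norm_add_le _ _).trans (add_le_add ((Hred m).le_opNorm _)
            (by rw [norm_smul, Real.norm_of_nonneg hm.le]))
      _ ≤ (β * αhigh ^ 2 + lam m) * ‖w m‖ := by
          rw [add_mul]; gcongr; exact hHred_norm m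
  have hw_pos : ∀ m, 0 < lam m → g m ≠ 0 → 0 < ‖w m‖ := by
    intro m hm hgm
    have hlhs : 0 < κa * αlow * ‖g m‖ := by positivity
    exact pos_of_mul_pos_right (hlhs.trans_le (hw_norm m hm)) (by positivity)
  have hpred_pos : ∀ m, 0 < lam m → g m ≠ 0 → 0 < Q m 0 - Q m (step m) := by
    intro m hm hgm
    have hwpos := hw_pos m hm hgm
    exact lt_of_lt_of_le (by positivity) (hpred m hm)
  have hthreshold : ∀ m, 0 < lam m → g m ≠ 0 → ρ m < ρs →
      lam m ≤ β * αhigh ^ 2 / (2 * (1 - ρs)) := by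
    intro m hm hgm hlt
    rw [hρ, div_lt_iff₀ (hpred_pos m hm hgm)] at hlt
    have hdescent := le_add_inner_gradient_add_sq hL hHnorm (f m) (step m)
    rw [← hg] at hdescent
    have hp := hpred m hm
    have hsq : ‖step m‖ ^ 2 ≤ αhigh ^ 2 * ‖w m‖ ^ 2 := by
      rw [← mul_pow]; gcongr; exact hstep_norm m
    have hQ' : Q m 0 - Q m (step m) =
        - ⟪g m, step m⟫ - (1 / 2) * ⟪step m, Hess m (step m)⟫ := by
      simp only [hQ, inner_zero_right, inner_zero_left]; ring
    have hwpos := hw_pos m hm hgm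
    have hred : (1 - ρs) * (Q m 0 - Q m (step m)) ≤ β / 2 * (αhigh ^ 2 * ‖w m‖ ^ 2) := by
      nlinarith [hstep_psd m, mul_le_mul_of_nonneg_left hsq hβ.le]
    have hlam : (1 - ρs) * (lam m * ‖w m‖ ^ 2) ≤ β / 2 * (αhigh ^ 2 * ‖w m‖ ^ 2) :=
      (mul_le_mul_of_nonneg_left hp (by linarith)).trans hred
    rw [le_div_iff₀ (by linarith)]
    refine le_of_mul_le_mul_right ?_ (pow_pos hwpos 2)
    linarith
  obtain ⟨hmono, ⟨K, hK⟩, hev⟩ := exists_bound_and_eventually_not_of_scaling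
    (u := lam) (p := fun m => g m ≠ 0 ∧ ρ m < ρs) hγup (hlamLow.trans_le hlam0)
    (fun m hm => ((hupd m).1 hm.1).2.2.1 hm.2)
    (fun m hm => by
      by_cases hgm : g m = 0
      · exact ((hupd m).2 hgm).2
      · exact ((hupd m).1 hgm).2.2.2 fun hlt => hm ⟨hgm, hlt⟩)
    (fun m hpos hm => hthreshold m hpos hm.1 hm.2)
  have hlam_low : ∀ m, lamLow ≤ lam m := fun m => hlam0.trans (hmono (Nat.zero_le m))
  have hlam_pos : ∀ m, 0 < lam m := fun m => hlamLow.trans_le (hlam_low m)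
  have hKpos : 0 < K := (hlam_pos 0).trans_le (hK 0)
  have hρs : 0 < ρs := hρapos.trans hρas
  have hD : 0 < β * αhigh ^ 2 + K := by positivity
  simp only [← hg]
  refine tendsto_norm_zero_of_sufficient_decrease (u := fun m => L (f m))
    (c := ρs * (lamLow * (κa * αlow / (β * αhigh ^ 2 + K)) ^ 2)) (by positivity)
    (hbdd.mono (Set.range_comp_subset_range f L)) ?_
  filter_upwards [hev] with m hm
  by_cases hgm : g m = 0
  · simp [hgm, ((hupd m).2 hgm).1]
  have hρm : ρs ≤ ρ m := not_lt.1 fun hlt => hm ⟨hgm, hlt⟩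
  rw [((hupd m).1 hgm).1 (hρas.trans_le hρm)]
  rw [hρ, le_div_iff₀ (hpred_pos m (hlam_pos m) hgm)] at hρm
  have hwlow : κa * αlow / (β * αhigh ^ 2 + K) * ‖g m‖ ≤ ‖w m‖ := by
    rw [div_mul_eq_mul_div, div_le_iff₀ hD, mul_comm ‖w m‖]
    exact (hw_norm m (hlam_pos m)).trans (by gcongr; exact hK m)
  calc _ = ρs * (lamLow * (κa * αlow / (β * αhigh ^ 2 + K) * ‖g m‖) ^ 2) := by ring
    _ ≤ ρs * (lam m * ‖w m‖ ^ 2) := by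
        gcongr
        exacts [(hlam_pos m).le, hlam_low m]
    _ ≤ ρs * (Q m 0 - Q m (step m)) :=
        mul_le_mul_of_nonneg_left (hpred m (hlam_pos m)) hρs.le
    _ ≤ _ := hρm
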